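/- Almost-superadditivity of the expected log-norms. Assume that the compact set K of Borel probability measures on SL(d,ℝ) satisfies the finite moment condition, the measures condition, and the spaces condition, and fix a sequence μ₁, μ₂, … ∈ K. For m ≥ n set T_{[n,m]} = A_m ⋯ A_{n+1} and L_{[n,m]} = E log‖T_{[n,m]}‖. Then for any ε > 0 there exists a constant C_ε (depending only on ε and K) such that for all n and all m ≥ n, L_m ≥ Lₙ + (1 − ε) L_{[n,m]} − C_ε. -/

import Mathlib

open MeasureTheory Matrix Filter
open scoped ENNReal

noncomputable section

/-- `SL(d, ℝ)`. -/
abbrev SL (d : ℕ) := Matrix.SpecialLinearGroup (Fin d) ℝ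

instance (d : ℕ) : TopologicalSpace (SL d) :=
  inferInstanceAs (TopologicalSpace { A : Matrix (Fin d) (Fin d) ℝ // A.det = 1 })

instance (d : ℕ) : MeasurableSpace (SL d) := borel _
instance (d : ℕ) : BorelSpace (SL d) := ⟨rfl⟩

/-- Operator norm of a real `d × d` matrix, acting on Euclidean space. -/
def opNorm {d : ℕ} (A : Matrix (Fin d) (Fin d) ℝ) : ℝ :=
  ‖Matrix.toEuclideanCLM (𝕜 := ℝ) A‖

/-- The norm `‖A‖` of `A ∈ SL(d, ℝ)`. -/
def slNorm {d : ℕ} (A : SL d) : ℝ := opNorm (A : Matrix (Fin d) (Fin d) ℝ)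

/-- `A` applied to a vector `v ∈ ℝ^d` (with the Euclidean norm). -/
def slVec {d : ℕ} (A : SL d) (v : EuclideanSpace ℝ (Fin d)) : EuclideanSpace ℝ (Fin d) :=
  Matrix.toEuclideanCLM (𝕜 := ℝ) (A : Matrix (Fin d) (Fin d) ℝ) v

/-- The random (reversed) product `Tₙ = Aₙ ⋯ A₂ A₁`, where `Aᵢ = ω (i-1)`. -/
def T {d : ℕ} (ω : ℕ → SL d) : ℕ → SL d
  | 0 => 1
  | n + 1 => ω n * T ω n

/-- The projective space `ℝP^{d-1}`. -/
abbrev Proj (d : ℕ) := Projectivization ℝ (Fin d → ℝ)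

instance (d : ℕ) : TopologicalSpace (Proj d) :=
  inferInstanceAs (TopologicalSpace (Quotient (projectivizationSetoid ℝ (Fin d → ℝ))))

instance (d : ℕ) : MeasurableSpace (Proj d) := borel _
instance (d : ℕ) : BorelSpace (Proj d) := ⟨rfl⟩

/-- The linear map induced by `A ∈ SL(d, ℝ)` is injective. -/
theorem toLin'_injective {d : ℕ} (A : SL d) :
    Function.Injective (Matrix.toLin' (A : Matrix (Fin d) (Fin d) ℝ)) := by
  apply Function.LeftInverse.injective
    (g := Matrix.toLin' ((A⁻¹ : SL d) : Matrix (Fin d) (Fin d) ℝ))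
  intro x
  rw [← Matrix.toLin'_mul_apply, ← Matrix.SpecialLinearGroup.coe_mul, inv_mul_cancel,
    Matrix.SpecialLinearGroup.coe_one, Matrix.toLin'_one, LinearMap.id_apply]

/-- The projective map `f_A : ℝP^{d-1} → ℝP^{d-1}` induced by `A ∈ SL(d, ℝ)`. -/
def projMap {d : ℕ} (A : SL d) : Proj d → Proj d :=
  Projectivization.map (Matrix.toLin' (A : Matrix (Fin d) (Fin d) ℝ)) (toLin'_injective A)

/-- The subset `[L] ⊆ ℝP^{d-1}` corresponding to a linear subspace `L ≤ ℝ^d`. -/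
def projSet {d : ℕ} (L : Submodule ℝ (Fin d → ℝ)) : Set (Proj d) :=
  {x : Proj d | x.submodule ≤ L}

/-- Finite moment condition for a single measure, with exponent `γ` and bound `C`. -/
def FiniteMomentCondition {d : ℕ} (γ C : ℝ) (μ : ProbabilityMeasure (SL d)) : Prop :=
  ∫⁻ A, ENNReal.ofReal (slNorm A ^ γ) ∂(μ : Measure (SL d)) < ENNReal.ofReal C

/-- Log-moment condition: `∫ log ‖A‖ dμ(A) < ∞`. -/
def LogMomentCondition {d : ℕ} (μ : ProbabilityMeasure (SL d)) : Prop :=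
  ∫⁻ A, ENNReal.ofReal (Real.log (slNorm A)) ∂(μ : Measure (SL d)) < ⊤

/-- Measures condition: there are no Borel probability measures `ν₁`, `ν₂` on `ℝP^{d-1}`
with `(f_A)_* ν₁ = ν₂` for `μ`-a.e. `A`. -/
def MeasuresCondition {d : ℕ} (μ : ProbabilityMeasure (SL d)) : Prop :=
  ¬ ∃ (ν₁ ν₂ : ProbabilityMeasure (Proj d)),
      ∀ᵐ A ∂(μ : Measure (SL d)),
        (ν₁ : Measure (Proj d)).map (projMap A) = (ν₂ : Measure (Proj d))

/-- `U ⊆ ℝ^d` is a (nonempty) finite union of proper nonzero linear subspaces. -/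
def IsFiniteUnionOfProperSubspaces {d : ℕ} (U : Set (Fin d → ℝ)) : Prop :=
  ∃ S : Set (Submodule ℝ (Fin d → ℝ)), S.Finite ∧ S.Nonempty ∧
    (∀ W ∈ S, W ≠ ⊥ ∧ W ≠ ⊤) ∧ U = ⋃ W ∈ S, (W : Set (Fin d → ℝ))

/-- `U ⊆ ℝ^d` is a (nonempty) finite union of `j`-dimensional linear subspaces. -/
def IsFiniteUnionOfDimSubspaces {d : ℕ} (j : ℕ) (U : Set (Fin d → ℝ)) : Prop :=
  ∃ S : Set (Submodule ℝ (Fin d → ℝ)), S.Finite ∧ S.Nonempty ∧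
    (∀ W ∈ S, Module.finrank ℝ W = j) ∧ U = ⋃ W ∈ S, (W : Set (Fin d → ℝ))

/-- Spaces condition: there are no two finite unions `U`, `U'` of proper nonzero subspaces
of `ℝ^d` such that `A(U) = U'` for `μ`-a.e. `A`. -/
def SpacesCondition {d : ℕ} (μ : ProbabilityMeasure (SL d)) : Prop :=
  ¬ ∃ U U' : Set (Fin d → ℝ), IsFiniteUnionOfProperSubspaces U ∧
      IsFiniteUnionOfProperSubspaces U' ∧
      ∀ᵐ (A : SL d) ∂(μ : Measure (SL d)),
        (fun v => Matrix.toLin' (A : Matrix (Fin d) (Fin d) ℝ) v) '' U = U'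

/-- `ℙ` is the product measure `μ₁ × μ₂ × ⋯` on sequences, characterized by its
finite-dimensional marginals. -/
def IsProductMeasure {d : ℕ} (μ : ℕ → ProbabilityMeasure (SL d))
    (ℙ : Measure (ℕ → SL d)) : Prop :=
  IsProbabilityMeasure ℙ ∧
    ∀ n : ℕ, ℙ.map (fun ω (i : Fin n) => ω i) =
      Measure.pi (fun i : Fin n => ((μ i : Measure (SL d))))

/-- `Lₙ = E log ‖Tₙ‖`. -/
def L {d : ℕ} (ℙ : Measure (ℕ → SL d)) (n : ℕ) : ℝ :=
  ∫ ω, Real.log (slNorm (T ω n)) ∂ℙ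

/-- `L_{[n,m]} = E log ‖A_m ⋯ A_{n+1}‖`. -/
def Lseg {d : ℕ} (ℙ : Measure (ℕ → SL d)) (n m : ℕ) : ℝ :=
  ∫ ω, Real.log (slNorm (T ω m * (T ω n)⁻¹)) ∂ℙ

/-! ### Linear algebra in `SL(d, ℝ)` -/

/-- Euclidean space `ℝ^d`. -/
abbrev Eucl (d : ℕ) := EuclideanSpace ℝ (Fin d)

/-- The unit sphere of `ℝ^d`. -/
abbrev Sph (d : ℕ) := Metric.sphere (0 : Eucl d) 1

theorem slVec_mul {d : ℕ} (A B : SL d) (v : Eucl d) : slVec (A * B) v = slVec A (slVec B v) := by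
  simp [slVec]

theorem slVec_one {d : ℕ} (v : Eucl d) : slVec (1 : SL d) v = v := by
  simp [slVec]

theorem slVec_inv_slVec {d : ℕ} (A : SL d) (v : Eucl d) : slVec A⁻¹ (slVec A v) = v := by
  rw [← slVec_mul, inv_mul_cancel, slVec_one]

theorem slVec_slVec_inv {d : ℕ} (A : SL d) (v : Eucl d) : slVec A (slVec A⁻¹ v) = v := by
  rw [← slVec_mul, mul_inv_cancel, slVec_one]

theorem slVec_smul {d : ℕ} (A : SL d) (c : ℝ) (v : Eucl d) :
    slVec A (c • v) = c • slVec A v := by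
  simp [slVec]

theorem slVec_ne_zero {d : ℕ} (A : SL d) {v : Eucl d} (hv : v ≠ 0) : slVec A v ≠ 0 := by
  intro h
  apply hv
  rw [← slVec_inv_slVec A v, h]
  simp [slVec]

theorem norm_slVec_le {d : ℕ} (A : SL d) (v : Eucl d) : ‖slVec A v‖ ≤ slNorm A * ‖v‖ :=
  ContinuousLinearMap.le_opNorm _ _

theorem slNorm_nonneg {d : ℕ} (A : SL d) : 0 ≤ slNorm A := norm_nonneg _

theorem slNorm_mul_le {d : ℕ} (A B : SL d) : slNorm (A * B) ≤ slNorm A * slNorm B := by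
  simp only [slNorm, opNorm, Matrix.SpecialLinearGroup.coe_mul, map_mul]
  exact norm_mul_le _ _

theorem slNorm_one {d : ℕ} (hd : 0 < d) : slNorm (1 : SL d) = 1 := by
  have : Nonempty (Fin d) := ⟨⟨0, hd⟩⟩
  simp [slNorm, opNorm]

theorem slNorm_pow_le {d : ℕ} (hd : 0 < d) (A : SL d) (n : ℕ) :
    slNorm (A ^ n) ≤ slNorm A ^ n := by
  induction n with
  | zero => simp [slNorm_one hd]
  | succ n ih =>
    rw [pow_succ, pow_succ]
    exact (slNorm_mul_le _ _).trans (mul_le_mul_of_nonneg_right ih (slNorm_nonneg _))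

theorem abs_apply_le_slNorm {d : ℕ} (A : SL d) (i j : Fin d) :
    |(A : Matrix (Fin d) (Fin d) ℝ) i j| ≤ slNorm A := by
  have h1 : (slVec A (EuclideanSpace.single j 1)) i = (A : Matrix (Fin d) (Fin d) ℝ) i j := by
    simp [slVec]
  have h2 := norm_slVec_le A (EuclideanSpace.single j 1)
  have h3 := PiLp.norm_apply_le (slVec A (EuclideanSpace.single j 1)) i
  rw [h1, Real.norm_eq_abs] at h3
  simpa using h3.trans h2

theorem one_le_slNorm {d : ℕ} (hd : 0 < d) (A : SL d) : 1 ≤ slNorm A := by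
  by_contra! h
  have key : ∀ n : ℕ, (1 : ℝ) ≤ d.factorial * (slNorm A ^ n) ^ d := by
    intro n
    have := Matrix.det_le (A := ((A ^ n : SL d) : Matrix (Fin d) (Fin d) ℝ))
      (abv := (IsAbsoluteValue.toAbsoluteValue (abs : ℝ → ℝ))) (x := slNorm A ^ n)
      (fun i j => (abs_apply_le_slNorm (A ^ n) i j).trans (slNorm_pow_le hd A n))
    rw [(A ^ n).det_coe] at this
    simpa using this
  have hlim : Tendsto (fun n : ℕ => (d.factorial : ℝ) * (slNorm A ^ n) ^ d) atTop (nhds 0) := by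
    have := ((tendsto_pow_atTop_nhds_zero_of_lt_one (slNorm_nonneg A) h).pow d).const_mul
      (d.factorial : ℝ)
    simpa [hd.ne'] using this
  exact absurd (ge_of_tendsto' hlim key) (by norm_num)

theorem slNorm_le_of_apply_le {d : ℕ} (A : SL d) {c : ℝ} (hc : 0 ≤ c)
    (h : ∀ i j, |(A : Matrix (Fin d) (Fin d) ℝ) i j| ≤ c) : slNorm A ≤ d * d * c := by
  refine ContinuousLinearMap.opNorm_le_bound _ (by positivity) fun v => ?_
  calc ‖slVec A v‖ ≤ ∑ i, ‖slVec A v i‖ := by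
        rw [EuclideanSpace.norm_eq]
        refine Real.sqrt_le_iff.2 ⟨by positivity, ?_⟩
        exact Finset.sum_sq_le_sq_sum_of_nonneg fun i _ => norm_nonneg _
    _ ≤ ∑ i : Fin d, ∑ j : Fin d, c * ‖v‖ := by
        refine Finset.sum_le_sum fun i _ => ?_
        have : slVec A v i = ∑ j, (A : Matrix (Fin d) (Fin d) ℝ) i j * v j := by
          simp [slVec, Matrix.mulVec, dotProduct]
        rw [this]
        refine (norm_sum_le _ _).trans (Finset.sum_le_sum fun j _ => ?_)
        rw [norm_mul]
        exact mul_le_mul (h i j) (PiLp.norm_apply_le v j) (norm_nonneg _) hc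
    _ = d * d * c * ‖v‖ := by simp; ring

theorem slNorm_inv_le {d : ℕ} (hd : 0 < d) (A : SL d) :
    slNorm A⁻¹ ≤ d * d * d.factorial * slNorm A ^ d := by
  rw [mul_assoc]
  refine slNorm_le_of_apply_le _ (by have := slNorm_nonneg A; positivity) fun i j => ?_
  rw [Matrix.SpecialLinearGroup.coe_inv, Matrix.adjugate_apply]
  have := Matrix.det_le (A := (A : Matrix (Fin d) (Fin d) ℝ).updateRow j (Pi.single i 1))
      (abv := (IsAbsoluteValue.toAbsoluteValue (abs : ℝ → ℝ))) (x := slNorm A) (fun k l => ?_)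
  · simpa using this
  · by_cases hk : k = j
    · subst hk
      by_cases hl : l = i
      · subst hl; simpa using one_le_slNorm hd A
      · simpa [hl] using slNorm_nonneg A
    · simpa [hk] using abs_apply_le_slNorm A k l

theorem exists_norm_slVec_eq {d : ℕ} (hd : 0 < d) (A : SL d) :
    ∃ x : Sph d, ‖slVec A x‖ = slNorm A := by
  have : Nonempty (Fin d) := ⟨⟨0, hd⟩⟩
  obtain ⟨x, hx, hmax⟩ := (isCompact_sphere (0 : Eucl d) 1).exists_isMaxOn
    (NormedSpace.sphere_nonempty.2 zero_le_one)
    (f := fun v => ‖slVec A v‖) (by unfold slVec; fun_prop)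
  refine ⟨⟨x, hx⟩, le_antisymm ?_ ?_⟩
  · simpa [mem_sphere_zero_iff_norm.1 hx] using norm_slVec_le A x
  · refine ContinuousLinearMap.opNorm_le_of_unit_norm (norm_nonneg _) fun v hv => ?_
    exact hmax (mem_sphere_zero_iff_norm.2 hv)

/-- The top right singular direction of `A`. -/
theorem exists_slNorm_mul_inner_le {d : ℕ} (hd : 0 < d) (A : SL d) :
    ∃ v : Sph d, ∀ x : Eucl d, slNorm A * |inner ℝ x (v : Eucl d)| ≤ ‖slVec A x‖ := by
  have hpos : 0 < slNorm A := one_pos.trans_le (one_le_slNorm hd A)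
  obtain ⟨x₀, hx₀⟩ := exists_norm_slVec_eq hd A.transpose
  have hadj : ∀ x y : Eucl d, inner ℝ x (slVec A.transpose y) = inner ℝ (slVec A x) y := by
    intro x y
    simp only [slVec, EuclideanSpace.inner_eq_star_dotProduct]
    simp [Matrix.dotProduct_mulVec, Matrix.mulVec_transpose, dotProduct_comm]
  have hnorm : slNorm A.transpose = slNorm A := by
    have : (A.transpose : Matrix (Fin d) (Fin d) ℝ) = star (A : Matrix (Fin d) (Fin d) ℝ) := by
      ext; simp [Matrix.star_apply]
    rw [slNorm, opNorm, this, map_star]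
    exact norm_star (Matrix.toEuclideanCLM (𝕜 := ℝ) (A : Matrix (Fin d) (Fin d) ℝ))
  refine ⟨⟨(slNorm A)⁻¹ • slVec A.transpose x₀, ?_⟩, fun x => ?_⟩
  · rw [mem_sphere_zero_iff_norm, norm_smul, hx₀, hnorm, norm_inv, Real.norm_of_nonneg hpos.le,
      inv_mul_cancel₀ hpos.ne']
  · simp only [inner_smul_right, hadj, abs_mul, abs_inv, abs_of_pos hpos]
    rw [mul_inv_cancel_left₀ hpos.ne']
    simpa using abs_real_inner_le_norm (slVec A x) (x₀ : Eucl d)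

/-! ### Topology of `SL(d, ℝ)` and its action on the sphere -/

instance (d : ℕ) : IsTopologicalGroup (SL d) := Matrix.SpecialLinearGroup.topologicalGroup

theorem isEmbedding_coe_SL (d : ℕ) :
    Topology.IsEmbedding (fun A : SL d => (A : Matrix (Fin d) (Fin d) ℝ)) :=
  Topology.IsEmbedding.subtypeVal

instance (d : ℕ) : TopologicalSpace.PseudoMetrizableSpace (SL d) :=
  have : TopologicalSpace.PseudoMetrizableSpace (Matrix (Fin d) (Fin d) ℝ) :=
    inferInstanceAs (TopologicalSpace.PseudoMetrizableSpace (Fin d → Fin d → ℝ))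
  (isEmbedding_coe_SL d).isInducing.pseudoMetrizableSpace

instance (d : ℕ) : SecondCountableTopology (SL d) :=
  have : SecondCountableTopology (Matrix (Fin d) (Fin d) ℝ) :=
    inferInstanceAs (SecondCountableTopology (Fin d → Fin d → ℝ))
  (isEmbedding_coe_SL d).secondCountableTopology

theorem continuous_slVec (d : ℕ) : Continuous (fun p : SL d × Eucl d => slVec p.1 p.2) := by
  have : (fun p : SL d × Eucl d => slVec p.1 p.2) =
      fun p => WithLp.toLp 2 ((p.1 : Matrix (Fin d) (Fin d) ℝ) *ᵥ WithLp.ofLp p.2) := by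
    ext p i; simp [slVec]
  rw [this]
  refine (PiLp.continuous_toLp 2 _).comp (Continuous.matrix_mulVec ?_ ?_)
  · exact (isEmbedding_coe_SL d).continuous.comp continuous_fst
  · fun_prop

theorem continuous_slNorm (d : ℕ) : Continuous (slNorm : SL d → ℝ) := by
  have : Continuous (Matrix.toEuclideanCLM (n := Fin d) (𝕜 := ℝ)) :=
    LinearMap.continuous_of_finiteDimensional
      ((Matrix.toEuclideanCLM (n := Fin d) (𝕜 := ℝ)) :
        Matrix (Fin d) (Fin d) ℝ →ₗ[ℝ] (Eucl d →L[ℝ] Eucl d))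
  exact (this.comp (isEmbedding_coe_SL d).continuous).norm

theorem sph_norm {d : ℕ} (x : Sph d) : ‖(x : Eucl d)‖ = 1 := mem_sphere_zero_iff_norm.1 x.2

theorem sph_ne_zero {d : ℕ} (x : Sph d) : (x : Eucl d) ≠ 0 :=
  norm_ne_zero_iff.1 (by rw [sph_norm]; exact one_ne_zero)

/-- The projective action of `SL(d, ℝ)` on the unit sphere. -/
def sphAct {d : ℕ} (A : SL d) (x : Sph d) : Sph d :=
  ⟨‖slVec A x‖⁻¹ • slVec A x, by
    rw [mem_sphere_zero_iff_norm, norm_smul, norm_inv, norm_norm,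
      inv_mul_cancel₀ (norm_ne_zero_iff.2 (slVec_ne_zero A (sph_ne_zero x)))]⟩

theorem continuous_sphAct (d : ℕ) : Continuous (fun p : SL d × Sph d => sphAct p.1 p.2) := by
  have h : Continuous (fun p : SL d × Sph d => slVec p.1 (p.2 : Eucl d)) :=
    Continuous.comp (g := fun q : SL d × Eucl d => slVec q.1 q.2)
      (f := fun p : SL d × Sph d => (p.1, (p.2 : Eucl d))) (continuous_slVec d)
      (Continuous.prodMk continuous_fst (continuous_subtype_val.comp continuous_snd))
  exact Continuous.subtype_mk ((h.norm.inv₀ fun p =>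
    norm_ne_zero_iff.2 (slVec_ne_zero _ (sph_ne_zero _))).smul h) _

theorem norm_smul_sphAct {d : ℕ} (A : SL d) (x : Sph d) :
    ‖slVec A x‖ • (sphAct A x : Eucl d) = slVec A x :=
  smul_inv_smul₀ (norm_ne_zero_iff.2 (slVec_ne_zero A (sph_ne_zero x))) _

theorem sphAct_mul {d : ℕ} (A B : SL d) (x : Sph d) :
    sphAct (A * B) x = sphAct A (sphAct B x) := by
  have hB : ‖slVec B x‖ ≠ 0 := norm_ne_zero_iff.2 (slVec_ne_zero B (sph_ne_zero x))
  have h : slVec (A * B) x = ‖slVec B x‖ • slVec A (sphAct B x) := by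
    rw [slVec_mul, ← slVec_smul, norm_smul_sphAct]
  ext1
  simp only [sphAct, h, norm_smul, norm_norm, mul_inv]
  rw [smul_smul, mul_right_comm, inv_mul_cancel₀ hB, one_mul]

/-- `μ * ν`: the law of the direction of `A x` when `A ∼ μ` and `x ∼ ν` are independent. -/
def sphConv {d : ℕ} (μ : ProbabilityMeasure (SL d)) (ν : ProbabilityMeasure (Sph d)) :
    ProbabilityMeasure (Sph d) :=
  (μ.prod ν).map (continuous_sphAct d).measurable.aemeasurable

theorem continuous_sphConv (d : ℕ) :
    Continuous (fun p : ProbabilityMeasure (SL d) × ProbabilityMeasure (Sph d) =>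
      sphConv p.1 p.2) :=
  (ProbabilityMeasure.continuous_map (continuous_sphAct d)).comp
    ProbabilityMeasure.continuous_prod

theorem sphConv_apply {d : ℕ} (μ : ProbabilityMeasure (SL d)) (ν : ProbabilityMeasure (Sph d))
    {s : Set (Sph d)} (hs : MeasurableSet s) :
    (sphConv μ ν : Measure (Sph d)) s = ∫⁻ A, (ν : Measure (Sph d)) (sphAct A ⁻¹' s) ∂μ := by
  have hm := (continuous_sphAct d).measurable
  rw [sphConv, ProbabilityMeasure.toMeasure_map, Measure.map_apply hm hs,
    ProbabilityMeasure.toMeasure_prod, Measure.prod_apply (hm hs)]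
  rfl

/-- Directions reachable after `n` random steps with laws in `K`. -/
def reach {d : ℕ} (K : Set (ProbabilityMeasure (SL d))) : ℕ → Set (ProbabilityMeasure (Sph d))
  | 0 => Set.univ
  | n + 1 => (fun p : ProbabilityMeasure (SL d) × ProbabilityMeasure (Sph d) =>
      sphConv p.1 p.2) '' (K ×ˢ reach K n)

theorem isCompact_reach {d : ℕ} {K : Set (ProbabilityMeasure (SL d))} (hK : IsCompact K) (n : ℕ) :
    IsCompact (reach K n) := by
  induction n with
  | zero => exact isCompact_univ
  | succ n ih => exact (hK.prod ih).image (continuous_sphConv d)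

theorem reach_succ_subset {d : ℕ} (K : Set (ProbabilityMeasure (SL d))) (n : ℕ) :
    reach K (n + 1) ⊆ reach K n := by
  induction n with
  | zero => exact Set.subset_univ _
  | succ n ih => exact Set.image_mono (Set.prod_mono le_rfl ih)

/-- Laws having an infinite past with laws in `K`. -/
def reachInf {d : ℕ} (K : Set (ProbabilityMeasure (SL d))) : Set (ProbabilityMeasure (Sph d)) :=
  ⋂ n, reach K n

theorem isCompact_reachInf {d : ℕ} {K : Set (ProbabilityMeasure (SL d))} (hK : IsCompact K) :
    IsCompact (reachInf K) :=
  (isCompact_reach hK 0).of_isClosed_subset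
    (isClosed_iInter fun n => (isCompact_reach hK n).isClosed) (Set.iInter_subset _ 0)

theorem exists_sphConv_eq_of_mem_reachInf {d : ℕ} {K : Set (ProbabilityMeasure (SL d))}
    (hK : IsCompact K) {ν : ProbabilityMeasure (Sph d)} (hν : ν ∈ reachInf K) :
    ∃ μ ∈ K, ∃ ν' ∈ reachInf K, sphConv μ ν' = ν := by
  have hc : IsClosed {p : ProbabilityMeasure (SL d) × ProbabilityMeasure (Sph d) |
      sphConv p.1 p.2 = ν} := isClosed_singleton.preimage (continuous_sphConv d)
  have hcomp : ∀ n, IsCompact ((K ×ˢ reach K n) ∩ {p | sphConv p.1 p.2 = ν}) := fun n =>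
    (hK.prod (isCompact_reach hK n)).inter_right hc
  obtain ⟨⟨μ, ν'⟩, h⟩ := IsCompact.nonempty_iInter_of_sequence_nonempty_isCompact_isClosed
    (fun n => (K ×ˢ reach K n) ∩ {p | sphConv p.1 p.2 = ν})
    (fun n => Set.inter_subset_inter_left _ (Set.prod_mono le_rfl (reach_succ_subset K n)))
    (fun n => by
      obtain ⟨p, hp, hpν⟩ := Set.mem_iInter.1 hν (n + 1)
      exact ⟨p, hp, hpν⟩)
    (hcomp 0) (fun n => (hcomp n).isClosed)
  rw [Set.mem_iInter] at h
  exact ⟨μ, (h 0).1.1, ν', Set.mem_iInter.2 fun n => (h n).1.2, (h 0).2⟩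

/-! ### Limit laws do not charge proper subspaces -/

theorem upperSemicontinuous_measure_section {S Y : Type*} [TopologicalSpace S] [MeasurableSpace S]
    [OpensMeasurableSpace S] [SecondCountableTopology S] [TopologicalSpace.PseudoMetrizableSpace S]
    [TopologicalSpace Y] [MeasurableSpace Y] [OpensMeasurableSpace Y] [SecondCountableTopology Y]
    [TopologicalSpace.PseudoMetrizableSpace Y] {Z : Set (Y × S)} (hZ : IsClosed Z) :
    UpperSemicontinuous (fun p : ProbabilityMeasure S × Y =>
      (p.1 : Measure S) (Prod.mk p.2 ⁻¹' Z)) := by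
  have h1 : UpperSemicontinuous
      (fun κ : ProbabilityMeasure (Y × S) => (κ : Measure (Y × S)) Z) := fun κ =>
    upperSemicontinuousAt_iff_limsup_le.2
      (ProbabilityMeasure.limsup_measure_closed_le_of_tendsto tendsto_id hZ)
  have h2 : Continuous (fun p : ProbabilityMeasure S × Y => (diracProba p.2).prod p.1) :=
    ProbabilityMeasure.continuous_prod.comp
      (Continuous.prodMk (continuous_diracProba.comp continuous_snd) continuous_fst)
  convert h1.comp h2 using 2 with p
  simp only [Function.comp_apply, ProbabilityMeasure.toMeasure_prod]
  rw [Measure.prod_apply hZ.measurableSet]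
  change _ = ∫⁻ x, (p.1 : Measure S) (Prod.mk x ⁻¹' Z) ∂(Measure.dirac p.2)
  rw [lintegral_dirac' _ (measurable_measure_prodMk_left hZ.measurableSet)]

/-- The points of the sphere in a linear subspace. -/
def sphSet {d : ℕ} (W : Submodule ℝ (Eucl d)) : Set (Sph d) := {x | (x : Eucl d) ∈ W}

theorem isClosed_sphSet {d : ℕ} (W : Submodule ℝ (Eucl d)) : IsClosed (sphSet W) :=
  W.closed_of_finiteDimensional.preimage continuous_subtype_val

theorem exists_orthonormal_mem_iff {d j : ℕ} {W : Submodule ℝ (Eucl d)}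
    (hW : Module.finrank ℝ W = j) :
    ∃ v : Fin (d - j) → Eucl d, Orthonormal ℝ v ∧ ∀ x, x ∈ W ↔ ∀ i, inner ℝ (v i) x = 0 := by
  have hdim : Module.finrank ℝ Wᗮ = d - j := by
    have := W.finrank_add_finrank_orthogonal
    rw [finrank_euclideanSpace_fin] at this
    omega
  let b := (stdOrthonormalBasis ℝ Wᗮ).reindex (finCongr hdim)
  refine ⟨fun i => (b i : Eucl d), b.orthonormal.comp_linearIsometry Wᗮ.subtypeₗᵢ, fun x => ?_⟩
  refine ⟨fun hx i => Submodule.inner_left_of_mem_orthogonal hx (b i).2, fun h => ?_⟩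
  rw [← W.orthogonal_orthogonal, Submodule.mem_orthogonal]
  intro u hu
  have hu' : (⟨u, hu⟩ : Wᗮ) ∈ Submodule.span ℝ (Set.range b) := by
    rw [← OrthonormalBasis.coe_toBasis, Module.Basis.span_eq]; trivial
  have : ∀ w ∈ Submodule.span ℝ (Set.range b), inner ℝ (w : Eucl d) x = 0 := by
    intro w hw
    induction hw using Submodule.span_induction with
    | mem w hw => obtain ⟨i, rfl⟩ := hw; exact h i
    | zero => simp
    | add a b _ _ ha hb => simp [inner_add_left, ha, hb]
    | smul c a _ ha => simp [inner_smul_left, ha]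
  exact this _ hu'

theorem isCompact_orthonormal (d k : ℕ) : IsCompact {v : Fin k → Eucl d | Orthonormal ℝ v} := by
  refine Metric.isCompact_of_isClosed_isBounded ?_ ?_
  · have : {v : Fin k → Eucl d | Orthonormal ℝ v} =
        ⋂ i, ⋂ j, {v | inner ℝ (v i) (v j) = if i = j then (1 : ℝ) else 0} := by
      ext v; simp [orthonormal_iff_ite]
    rw [this]
    exact isClosed_iInter fun i => isClosed_iInter fun j =>
      isClosed_eq ((continuous_apply i).inner (continuous_apply j)) continuous_const
  · refine (Metric.isBounded_closedBall (x := (0 : Fin k → Eucl d)) (r := 1)).subset fun v hv => ?_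
    rw [mem_closedBall_zero_iff, pi_norm_le_iff_of_nonneg zero_le_one]
    exact fun i => (hv.1 i).le

theorem exists_max_sphSet {d j : ℕ} {X : Set (ProbabilityMeasure (Sph d))} (hX : IsCompact X)
    (hne : X.Nonempty) {W₀ : Submodule ℝ (Eucl d)} (hW₀ : Module.finrank ℝ W₀ = j) :
    ∃ ν ∈ X, ∃ W : Submodule ℝ (Eucl d), Module.finrank ℝ W = j ∧
      ∀ ν' ∈ X, ∀ W' : Submodule ℝ (Eucl d), Module.finrank ℝ W' = j →
        (ν' : Measure (Sph d)) (sphSet W') ≤ (ν : Measure (Sph d)) (sphSet W) := by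
  let Z : Set ((Fin (d - j) → Eucl d) × Sph d) := {p | ∀ i, inner ℝ (p.1 i) (p.2 : Eucl d) = 0}
  have hZ : IsClosed Z := by
    have : Z = ⋂ i, {p | inner ℝ (p.1 i) (p.2 : Eucl d) = (0 : ℝ)} := by ext; simp [Z]
    rw [this]
    refine isClosed_iInter fun i => isClosed_eq (Continuous.inner ?_ ?_) continuous_const
    · exact (continuous_apply i).comp continuous_fst
    · exact continuous_subtype_val.comp continuous_snd
  obtain ⟨v₀, hv₀, -⟩ := exists_orthonormal_mem_iff hW₀
  obtain ⟨ν₀, hν₀⟩ := hne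
  obtain ⟨⟨ν, v⟩, ⟨hν, hv⟩, hmax⟩ :=
    ((upperSemicontinuous_measure_section hZ).upperSemicontinuousOn
      (X ×ˢ {v | Orthonormal ℝ v})).exists_isMaxOn ⟨(ν₀, v₀), Set.mk_mem_prod hν₀ hv₀⟩
      (hX.prod (isCompact_orthonormal d (d - j)))
  refine ⟨ν, hν, (Submodule.span ℝ (Set.range v))ᗮ, ?_, fun ν' hν' W' hW' => ?_⟩
  · have h1 := (Submodule.span ℝ (Set.range v)).finrank_add_finrank_orthogonal
    have h2 := finrank_span_eq_card hv.linearIndependent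
    have h3 := W₀.finrank_le
    rw [finrank_euclideanSpace_fin] at h1 h3
    rw [Fintype.card_fin] at h2
    rw [h2] at h1
    omega
  · obtain ⟨v', hv', hmem⟩ := exists_orthonormal_mem_iff hW'
    have h1 : sphSet W' = Prod.mk v' ⁻¹' Z := by ext x; exact hmem x
    have h2 : Prod.mk v ⁻¹' Z ⊆ sphSet (Submodule.span ℝ (Set.range v))ᗮ := by
      intro x hx
      change ∀ i, inner ℝ (v i) (x : Eucl d) = 0 at hx
      change (x : Eucl d) ∈ (Submodule.span ℝ (Set.range v))ᗮ
      rw [Submodule.mem_orthogonal']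
      intro u hu
      induction hu using Submodule.span_induction with
      | mem w hw => obtain ⟨i, rfl⟩ := hw; rw [real_inner_comm]; exact hx i
      | zero => simp
      | add a b _ _ ha hb => simp [inner_add_right, ha, hb]
      | smul c a _ ha => simp [inner_smul_right, ha]
    rw [h1]
    exact (hmax (show (ν', v') ∈ _ from ⟨hν', hv'⟩)).trans (measure_mono h2)

/-- The linear automorphism of `ℝ^d` given by `A`. -/
def slEquiv {d : ℕ} (A : SL d) : Eucl d ≃ₗ[ℝ] Eucl d where
  toFun := slVec A
  invFun := slVec A⁻¹
  left_inv := slVec_inv_slVec A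
  right_inv := slVec_slVec_inv A
  map_add' x y := by simp [slVec]
  map_smul' c x := slVec_smul A c x

/-- The preimage of a subspace under `A`. -/
def pull {d : ℕ} (A : SL d) (W : Submodule ℝ (Eucl d)) : Submodule ℝ (Eucl d) :=
  W.comap (slEquiv A : Eucl d →ₗ[ℝ] Eucl d)

theorem mem_pull {d : ℕ} {A : SL d} {W : Submodule ℝ (Eucl d)} {x : Eucl d} :
    x ∈ pull A W ↔ slVec A x ∈ W := Iff.rfl

theorem pull_injective {d : ℕ} (A : SL d) : Function.Injective (pull A) :=
  Submodule.comap_injective_of_surjective (slEquiv A).surjective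

theorem finrank_pull {d : ℕ} (A : SL d) (W : Submodule ℝ (Eucl d)) :
    Module.finrank ℝ (pull A W) = Module.finrank ℝ W := by
  rw [pull, Submodule.comap_equiv_eq_map_symm]
  exact LinearEquiv.finrank_map_eq _ _

theorem sphAct_preimage_sphSet {d : ℕ} (A : SL d) (W : Submodule ℝ (Eucl d)) :
    sphAct A ⁻¹' sphSet W = sphSet (pull A W) := by
  ext x
  exact W.smul_mem_iff (inv_ne_zero (norm_ne_zero_iff.2 (slVec_ne_zero A (sph_ne_zero x))))

open Classical in
theorem SpacesCondition.not_ae_image_pull_eq {d : ℕ} {μ : ProbabilityMeasure (SL d)}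
    (hμ : SpacesCondition μ) {F F' : Finset (Submodule ℝ (Eucl d))} (hF : F.Nonempty)
    (hF' : F'.Nonempty) (hp : ∀ W ∈ F, W ≠ ⊥ ∧ W ≠ ⊤) (hp' : ∀ W ∈ F', W ≠ ⊥ ∧ W ≠ ⊤) :
    ¬ ∀ᵐ A ∂(μ : Measure (SL d)), F.image (pull A) = F' := by
  intro hae
  let e := WithLp.linearEquiv 2 ℝ (Fin d → ℝ)
  have hunion : ∀ G : Finset (Submodule ℝ (Eucl d)), G.Nonempty →
      (∀ W ∈ G, W ≠ ⊥ ∧ W ≠ ⊤) →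
      IsFiniteUnionOfProperSubspaces (⋃ W ∈ G, e '' (W : Set (Eucl d))) := by
    intro G hG hGp
    refine ⟨(fun W : Submodule ℝ (Eucl d) => W.map (e : Eucl d →ₗ[ℝ] (Fin d → ℝ))) '' G,
      G.finite_toSet.image _, hG.to_set.image _, ?_, ?_⟩
    · rintro _ ⟨W, hW, rfl⟩
      obtain ⟨h1, h2⟩ := hGp W hW
      constructor
      · simpa [Submodule.map_eq_bot_iff] using h1
      · intro h
        apply h2
        change W.map (e : Eucl d →ₗ[ℝ] (Fin d → ℝ)) = ⊤ at h
        rw [← Submodule.comap_map_eq_of_injective (f := (e : Eucl d →ₗ[ℝ] (Fin d → ℝ)))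
          e.injective W, h, Submodule.comap_top]
    · simp
  refine hμ ⟨_, _, hunion F' hF' hp', hunion F hF hp, ?_⟩
  filter_upwards [hae] with A hA
  have hA' : ∀ x : Eucl d, Matrix.toLin' (A : Matrix (Fin d) (Fin d) ℝ) (e x) = e (slVec A x) := by
    intro x; simp [e, slVec]
  ext y
  simp only [Set.mem_image, Set.mem_iUnion, exists_prop, SetLike.mem_coe]
  constructor
  · rintro ⟨_, ⟨W, hW, x, hx, rfl⟩, rfl⟩
    rw [← hA] at hW
    obtain ⟨W', hW', rfl⟩ := Finset.mem_image.1 hW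
    exact ⟨W', hW', slVec A x, hx, (hA' x).symm⟩
  · rintro ⟨W, hW, x, hx, rfl⟩
    refine ⟨e (slVec A⁻¹ x), ⟨pull A W, hA ▸ Finset.mem_image_of_mem _ hW, _, ?_, rfl⟩, ?_⟩
    · rw [mem_pull, slVec_slVec_inv]; exact hx
    · rw [hA', slVec_slVec_inv]

theorem ProbabilityMeasure.card_mul_le_one_of_aedisjoint {S ι : Type*} [MeasurableSpace S]
    (ν : ProbabilityMeasure S) {s : ι → Set S} (hs : ∀ i, MeasurableSet (s i)) {F : Finset ι}
    {m : ℝ≥0∞} (hm : ∀ i ∈ F, (ν : Measure S) (s i) = m)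
    (hd : ∀ i ∈ F, ∀ j ∈ F, i ≠ j → (ν : Measure S) (s i ∩ s j) = 0) : F.card * m ≤ 1 := by
  have h := measure_biUnion_finset₀ (μ := (ν : Measure S)) (s := F) (f := s)
    (fun i hi j hj hij => hd i hi j hj hij) (fun i _ => (hs i).nullMeasurableSet)
  rw [Finset.sum_congr rfl hm, Finset.sum_const, nsmul_eq_mul] at h
  rw [← h]
  exact prob_le_one

theorem ae_eq_of_le_of_lintegral_eq {G : Type*} [MeasurableSpace G] {μ : Measure G}
    [IsProbabilityMeasure μ] {f : G → ℝ≥0∞} {m : ℝ≥0∞} (hm : m ≠ ⊤)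
    (hle : ∀ A, f A ≤ m) (h_int : ∫⁻ A, f A ∂μ = m) : ∀ᵐ A ∂μ, f A = m := by
  have h := ae_eq_of_ae_le_of_lintegral_le (μ := μ) (f := f) (g := fun _ => m)
    (ae_of_all _ hle) (by rw [h_int]; exact hm) aemeasurable_const (by simp [h_int])
  exact h

theorem reachInf_sphSet_eq_zero {d : ℕ} {K : Set (ProbabilityMeasure (SL d))} (hK : IsCompact K)
    (hsp : ∀ μ ∈ K, SpacesCondition μ) {ν : ProbabilityMeasure (Sph d)} (hν : ν ∈ reachInf K)
    {W : Submodule ℝ (Eucl d)} (hW : W ≠ ⊤) : (ν : Measure (Sph d)) (sphSet W) = 0 := by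
  classical
  induction hj : Module.finrank ℝ W using Nat.strong_induction_on generalizing ν W with
  | _ j ih =>
  by_contra hpos
  have hjd : j < d := by
    have := Submodule.finrank_lt hW
    rwa [hj, finrank_euclideanSpace_fin] at this
  have hj0 : j ≠ 0 := by
    rintro rfl
    apply hpos
    rw [Submodule.finrank_eq_zero.1 hj]
    have hempty : sphSet (⊥ : Submodule ℝ (Eucl d)) = ∅ :=
      Set.eq_empty_of_forall_notMem fun x hx => sph_ne_zero x ((Submodule.mem_bot ℝ).1 hx)
    rw [hempty, measure_empty]
  have hproper : ∀ V : Submodule ℝ (Eucl d), Module.finrank ℝ V = j → V ≠ ⊥ ∧ V ≠ ⊤ := by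
    refine fun V hV => ⟨?_, ?_⟩ <;> rintro rfl
    · rw [finrank_bot] at hV; exact hj0 hV.symm
    · rw [finrank_top, finrank_euclideanSpace_fin] at hV; exact hjd.ne' hV
  obtain ⟨ν₁, hν₁, W₁, hW₁, hmax⟩ := exists_max_sphSet (isCompact_reachInf hK) ⟨ν, hν⟩ hj
  set m := (ν₁ : Measure (Sph d)) (sphSet W₁) with hm
  have hm0 : m ≠ 0 := fun h => hpos (le_antisymm (h ▸ hmax ν hν W hj) zero_le)
  have hmtop : m ≠ ⊤ := measure_ne_top _ _
  -- the families of subspaces of maximal mass have bounded cardinality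
  let P : ProbabilityMeasure (Sph d) → Finset (Submodule ℝ (Eucl d)) → Prop := fun ρ F =>
    ∀ V ∈ F, Module.finrank ℝ V = j ∧ (ρ : Measure (Sph d)) (sphSet V) = m
  have hcard : ∀ ρ ∈ reachInf K, ∀ F, P ρ F → (F.card : ℝ≥0∞) * m ≤ 1 := by
    intro ρ hρ F hF
    refine ProbabilityMeasure.card_mul_le_one_of_aedisjoint ρ (s := sphSet)
      (fun V => (isClosed_sphSet V).measurableSet) (fun V hV => (hF V hV).2) ?_
    intro V hV V' hV' hne
    have hlt : V ⊓ V' < V := by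
      refine lt_of_le_of_ne inf_le_left fun h => hne ?_
      exact Submodule.eq_of_le_of_finrank_eq (inf_eq_left.1 h)
        ((hF V hV).1.trans (hF V' hV').1.symm)
    have hlt' := Submodule.finrank_lt_finrank_of_lt hlt
    rw [(hF V hV).1] at hlt'
    exact ih _ hlt' hρ (hlt.trans_le le_top).ne rfl
  obtain ⟨N, hN⟩ : ∃ N : ℕ, (m⁻¹ : ℝ≥0∞) ≤ N := by
    obtain ⟨N, hN⟩ := ENNReal.exists_nat_gt (ENNReal.inv_ne_top.2 hm0)
    exact ⟨N, hN.le⟩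
  let Q : ℕ → Prop := fun r => ∃ ρ ∈ reachInf K, ∃ F, P ρ F ∧ F.card = r
  have hQN : ∀ r, Q r → r ≤ N := by
    rintro r ⟨ρ, hρ, F, hF, rfl⟩
    have h1 := hcard ρ hρ F hF
    have h2 : (F.card : ℝ≥0∞) ≤ m⁻¹ := ENNReal.le_inv_iff_mul_le.2 h1
    exact_mod_cast h2.trans hN
  have hQ1 : Q 1 := ⟨ν₁, hν₁, {W₁}, fun V hV => by
    rw [Finset.mem_singleton.1 hV]; exact ⟨hW₁, rfl⟩, Finset.card_singleton _⟩
  have hr1 : 1 ≤ Nat.findGreatest Q N := Nat.le_findGreatest (hQN 1 hQ1) hQ1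
  obtain ⟨ρ, hρ, F, hF, hFr⟩ := Nat.findGreatest_spec (hQN 1 hQ1) hQ1
  have hgreat : ∀ ρ ∈ reachInf K, ∀ G, P ρ G → G.card ≤ F.card := fun ρ' hρ' G hG => by
    rw [hFr]
    exact Nat.le_findGreatest (hQN _ ⟨ρ', hρ', G, hG, rfl⟩) ⟨ρ', hρ', G, hG, rfl⟩
  have hFne : F.Nonempty := Finset.card_pos.1 (by omega)
  -- pull the extremal family back one step
  obtain ⟨μ, hμ, ρ', hρ', rfl⟩ := exists_sphConv_eq_of_mem_reachInf hK hρ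
  have hae : ∀ᵐ A ∂(μ : Measure (SL d)), P ρ' (F.image (pull A)) := by
    have h1 : ∀ V ∈ F, ∀ᵐ A ∂(μ : Measure (SL d)),
        (ρ' : Measure (Sph d)) (sphSet (pull A V)) = m := by
      intro V hV
      have hVm := (isClosed_sphSet V).measurableSet
      have h2 := sphConv_apply μ ρ' hVm
      rw [(hF V hV).2] at h2
      simp only [sphAct_preimage_sphSet] at h2
      refine ae_eq_of_le_of_lintegral_eq hmtop (fun A => ?_) h2.symm
      exact hmax ρ' hρ' _ ((finrank_pull A V).trans (hF V hV).1)
    filter_upwards [(Filter.eventually_all_finset F).2 h1] with A hA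
    intro V' hV'
    obtain ⟨V, hV, rfl⟩ := Finset.mem_image.1 hV'
    exact ⟨(finrank_pull A V).trans (hF V hV).1, hA V hV⟩
  obtain ⟨A₀, hA₀⟩ := hae.exists
  refine (hsp μ hμ).not_ae_image_pull_eq hFne (hFne.image (pull A₀))
    (fun V hV => hproper V (hF V hV).1) (fun V hV => hproper V (hA₀ V hV).1) ?_
  filter_upwards [hae] with A hA
  have hU : P ρ' (F.image (pull A) ∪ F.image (pull A₀)) := fun V hV =>
    (Finset.mem_union.1 hV).elim (hA V) (hA₀ V)
  have hle := hgreat ρ' hρ' _ hU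
  have hc : ∀ B, (F.image (pull B)).card = F.card := fun B =>
    Finset.card_image_of_injective _ (pull_injective B)
  rw [Finset.eq_of_subset_of_card_le Finset.subset_union_left (hle.trans (hc A).ge),
    ← Finset.eq_of_subset_of_card_le Finset.subset_union_right (hle.trans (hc A₀).ge)]

/-- The points of the sphere making a small angle with the hyperplane `v^⊥`. -/
def slab {d : ℕ} (v : Sph d) (δ : ℝ) : Set (Sph d) :=
  {x | |inner ℝ (x : Eucl d) (v : Eucl d)| ≤ δ}

theorem isClosed_slab_prod (d : ℕ) (δ : ℝ) :
    IsClosed {p : Sph d × Sph d | |inner ℝ (p.2 : Eucl d) (p.1 : Eucl d)| ≤ δ} :=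
  isClosed_le (Continuous.abs (Continuous.inner (continuous_subtype_val.comp continuous_snd)
    (continuous_subtype_val.comp continuous_fst))) continuous_const

theorem isClosed_slab {d : ℕ} (v : Sph d) (δ : ℝ) : IsClosed (slab v δ) :=
  (isClosed_slab_prod d δ).preimage (Continuous.prodMk_right v)

theorem slab_mono {d : ℕ} (v : Sph d) {δ δ' : ℝ} (h : δ ≤ δ') : slab v δ ⊆ slab v δ' :=
  fun _ hx => le_trans hx h

theorem exists_slab_lt {d : ℕ} {K : Set (ProbabilityMeasure (SL d))} (hK : IsCompact K)
    (hsp : ∀ μ ∈ K, SpacesCondition μ) {ε : ℝ≥0∞} (hε : 0 < ε) :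
    ∃ k : ℕ, ∃ δ : ℝ, 0 < δ ∧ ∀ ν ∈ reach K k, ∀ v : Sph d,
      (ν : Measure (Sph d)) (slab v δ) < ε := by
  by_contra! hcon
  let δ : ℕ → ℝ := fun n => 1 / ((n : ℝ) + 1)
  have hδ : Antitone δ := fun a b hab => one_div_le_one_div_of_le (by positivity)
    (by have : (a : ℝ) ≤ b := by exact_mod_cast hab
        linarith)
  let F : ℕ → Set (ProbabilityMeasure (Sph d) × Sph d) := fun n =>
    (reach K n ×ˢ Set.univ) ∩ {p | ε ≤ (p.1 : Measure (Sph d)) (slab p.2 (δ n))}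
  have hcl : ∀ n, IsClosed
      {p : ProbabilityMeasure (Sph d) × Sph d | ε ≤ (p.1 : Measure (Sph d)) (slab p.2 (δ n))} :=
    fun n => (upperSemicontinuous_measure_section (isClosed_slab_prod d (δ n))).isClosed_preimage ε
  have hcomp : ∀ n, IsCompact (F n) := fun n =>
    ((isCompact_reach hK n).prod isCompact_univ).inter_right (hcl n)
  obtain ⟨⟨ν, v⟩, h⟩ := IsCompact.nonempty_iInter_of_sequence_nonempty_isCompact_isClosed F
    (fun n => Set.inter_subset_inter (Set.prod_mono (reach_succ_subset K n) le_rfl)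
      fun p hp => le_trans hp (measure_mono (slab_mono _ (hδ n.le_succ))))
    (fun n => by
      obtain ⟨ν, hν, v, hv⟩ := hcon n (δ n) (by positivity)
      exact ⟨(ν, v), ⟨hν, trivial⟩, hv⟩)
    (hcomp 0) (fun n => (hcomp n).isClosed)
  rw [Set.mem_iInter] at h
  have hν : ν ∈ reachInf K := Set.mem_iInter.2 fun n => (h n).1.1
  have hinter : ⋂ n, slab v (δ n) = sphSet (Submodule.span ℝ {(v : Eucl d)})ᗮ := by
    ext x
    rw [Set.mem_iInter]
    change (∀ n, |inner ℝ (x : Eucl d) (v : Eucl d)| ≤ δ n) ↔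
      (x : Eucl d) ∈ (Submodule.span ℝ {(v : Eucl d)})ᗮ
    rw [Submodule.mem_orthogonal_singleton_iff_inner_left]
    constructor
    · intro hx
      exact abs_nonpos_iff.1 (ge_of_tendsto' tendsto_one_div_add_atTop_nhds_zero_nat hx)
    · intro hx n
      rw [hx, abs_zero]
      positivity
  have hlim := tendsto_measure_iInter_atTop (μ := (ν : Measure (Sph d)))
    (fun n => (isClosed_slab v (δ n)).measurableSet.nullMeasurableSet)
    (fun a b hab => slab_mono v (hδ hab)) ⟨0, measure_ne_top _ _⟩
  rw [hinter, reachInf_sphSet_eq_zero hK hsp hν] at hlim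
  · exact absurd (ge_of_tendsto' hlim fun n => (h n).2) (not_le.2 hε)
  · intro htop
    have : (v : Eucl d) ∈ (Submodule.span ℝ {(v : Eucl d)})ᗮ := by rw [htop]; trivial
    rw [Submodule.mem_orthogonal_singleton_iff_inner_left] at this
    exact sph_ne_zero v (inner_self_eq_zero.1 this)

/-! ### Laws of random products -/

/-- The law of `A_{n+j} ⋯ A_{n+1}`. -/
def segLaw {d : ℕ} (μ : ℕ → ProbabilityMeasure (SL d)) (n : ℕ) : ℕ → Measure (SL d)
  | 0 => Measure.dirac 1
  | j + 1 => (μ (n + j) : Measure (SL d)) ∗ₘ segLaw μ n j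

instance {d : ℕ} (μ : ℕ → ProbabilityMeasure (SL d)) (n j : ℕ) :
    IsProbabilityMeasure (segLaw μ n j) := by
  induction j with
  | zero => exact Measure.dirac.isProbabilityMeasure
  | succ j ih => exact Measure.probabilitymeasure_of_probabilitymeasures_mconv _ _

theorem segLaw_add {d : ℕ} (μ : ℕ → ProbabilityMeasure (SL d)) (n i j : ℕ) :
    segLaw μ n (i + j) = segLaw μ (n + i) j ∗ₘ segLaw μ n i := by
  induction j with
  | zero => exact (Measure.dirac_one_mconv _).symm
  | succ j ih =>
    rw [← add_assoc, segLaw, segLaw, ih, ← add_assoc, Measure.mconv_assoc]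

theorem continuous_sphAct_left {d : ℕ} (x : Sph d) : Continuous (fun A : SL d => sphAct A x) :=
  Continuous.comp (g := fun p : SL d × Sph d => sphAct p.1 p.2) (f := fun A : SL d => (A, x))
    (continuous_sphAct d) (Continuous.prodMk continuous_id continuous_const)

theorem continuous_sphAct_right {d : ℕ} (A : SL d) : Continuous (fun x : Sph d => sphAct A x) :=
  Continuous.comp (g := fun p : SL d × Sph d => sphAct p.1 p.2) (f := fun x : Sph d => (A, x))
    (continuous_sphAct d) (Continuous.prodMk continuous_const continuous_id)

theorem exists_mem_reach_eq_map_segLaw {d : ℕ} {K : Set (ProbabilityMeasure (SL d))}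
    {μ : ℕ → ProbabilityMeasure (SL d)} (hμ : ∀ i, μ i ∈ K) (x : Sph d) (n k : ℕ) :
    ∃ ν ∈ reach K k, (ν : Measure (Sph d)) = (segLaw μ n k).map (fun A => sphAct A x) := by
  have hx := (continuous_sphAct_left x).measurable
  induction k with
  | zero => exact ⟨⟨_, Measure.isProbabilityMeasure_map hx.aemeasurable⟩, trivial, rfl⟩
  | succ k ih =>
    obtain ⟨ν, hν, hνx⟩ := ih
    refine ⟨sphConv (μ (n + k)) ν, ⟨(μ (n + k), ν), ⟨hμ _, hν⟩, rfl⟩, ?_⟩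
    ext s hs
    rw [sphConv_apply _ _ hs, segLaw, Measure.map_apply hx hs, Measure.mconv,
      Measure.map_apply measurable_mul (hx hs), Measure.prod_apply (measurable_mul (hx hs))]
    refine lintegral_congr fun A => ?_
    have hA : Measurable (sphAct A : Sph d → Sph d) := (continuous_sphAct_right A).measurable
    rw [hνx, Measure.map_apply hx (hA hs)]
    congr 1
    ext B
    simp [sphAct_mul]

theorem T_congr {d : ℕ} {ω ω' : ℕ → SL d} {n : ℕ} (h : ∀ i < n, ω i = ω' i) :
    T ω n = T ω' n := by
  induction n with
  | zero => rfl
  | succ n ih => rw [T, T, h n n.lt_succ_self, ih fun i hi => h i (hi.trans n.lt_succ_self)]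

theorem measurable_T {d : ℕ} (n : ℕ) : Measurable (fun ω : ℕ → SL d => T ω n) := by
  induction n with
  | zero => exact measurable_const
  | succ n ih => exact (measurable_pi_apply n).mul ih

theorem IsProductMeasure.map_prodMk {d : ℕ} {μ : ℕ → ProbabilityMeasure (SL d)}
    {ℙ : Measure (ℕ → SL d)} (hℙ : IsProductMeasure μ ℙ) (m : ℕ) :
    ℙ.map (fun ω => (ω m, fun i : Fin m => ω i)) =
      (μ m : Measure (SL d)).prod (Measure.pi fun i : Fin m => (μ i : Measure (SL d))) := by
  have h := (measurePreserving_piFinSuccAbove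
    (fun i : Fin (m + 1) => (μ i : Measure (SL d))) (Fin.last m)).map_eq
  rw [← hℙ.2 (m + 1), Measure.map_map (MeasurableEquiv.measurable _) (by fun_prop)] at h
  simp only [Fin.val_last, Fin.succAbove_last, Fin.val_castSucc] at h
  rw [← h]
  congr 1
  ext1 ω
  refine Prod.ext rfl (funext fun i => ?_)
  simp [MeasurableEquiv.piFinSuccAbove, Fin.insertNthEquiv, Fin.init]

theorem IsProductMeasure.map_seg {d : ℕ} {μ : ℕ → ProbabilityMeasure (SL d)}
    {ℙ : Measure (ℕ → SL d)} (hℙ : IsProductMeasure μ ℙ) (n j : ℕ) :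
    ℙ.map (fun ω => T ω (n + j) * (T ω n)⁻¹) = segLaw μ n j := by
  have := hℙ.1
  induction j with
  | zero => simp [segLaw, Measure.map_const]
  | succ j ih =>
    set m := n + j with hm
    let fill : (Fin m → SL d) → ℕ → SL d := fun x i => if h : i < m then x ⟨i, h⟩ else 1
    have h_fill : Measurable fill := by
      refine measurable_pi_lambda _ fun i => ?_
      by_cases h : i < m
      · simpa [fill, h] using measurable_pi_apply _
      · simp [fill, h]
    let g : (Fin m → SL d) → SL d := fun x => T (fill x) m * (T (fill x) n)⁻¹
    have hg : Measurable g :=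
      ((measurable_T m).comp h_fill).mul ((measurable_T n).comp h_fill).inv
    have hgT : ∀ ω : ℕ → SL d, g (fun i : Fin m => ω i) = T ω m * (T ω n)⁻¹ := by
      intro ω
      have h : ∀ i < m, fill (fun i : Fin m => ω i) i = ω i := fun i hi => by simp [fill, hi]
      simp only [g]
      rw [T_congr h, T_congr fun i hi => h i (by omega)]
    have hr : Measurable fun (ω : ℕ → SL d) (i : Fin m) => ω i := by fun_prop
    have hseg : (Measure.pi fun i : Fin m => (μ i : Measure (SL d))).map g = segLaw μ n j := by
      rw [← hℙ.2 m, Measure.map_map hg hr, ← ih]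
      congr 1
      exact funext hgT
    have hmul : Measurable fun p : SL d × (Fin m → SL d) => p.1 * g p.2 :=
      measurable_fst.mul (hg.comp measurable_snd)
    have hstep : (fun ω => T ω (n + (j + 1)) * (T ω n)⁻¹) =
        (fun p : SL d × (Fin m → SL d) => p.1 * g p.2) ∘ fun ω => (ω m, fun i : Fin m => ω i) := by
      ext1 ω
      simp only [Function.comp_apply, hgT]
      rw [← add_assoc, ← hm, T, mul_assoc]
    rw [hstep, ← Measure.map_map hmul ((measurable_pi_apply m).prodMk hr), hℙ.map_prodMk, segLaw,
      ← hm, Measure.mconv, ← hseg]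
    nth_rw 2 [← Measure.map_id (μ := (μ m : Measure (SL d)))]
    rw [Measure.map_prod_map _ _ measurable_id hg, Measure.map_map measurable_mul
      (measurable_id.prodMap hg)]
    rfl

/-! ### Logarithms of norms -/

/-- `log ‖A‖`. -/
def logNorm {d : ℕ} (A : SL d) : ℝ := Real.log (slNorm A)

/-- The additive constant in the comparison of `log ‖A⁻¹‖` with `d log ‖A‖`. -/
def invConst (d : ℕ) : ℝ := Real.log (d * d * d.factorial)

theorem invConst_nonneg {d : ℕ} (hd : 0 < d) : 0 ≤ invConst d := by
  have h : 1 ≤ d * d * d.factorial := Nat.succ_le_of_lt (by positivity)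
  exact Real.log_nonneg (by exact_mod_cast h)

theorem slNorm_pos {d : ℕ} (hd : 0 < d) (A : SL d) : 0 < slNorm A :=
  zero_lt_one.trans_le (one_le_slNorm hd A)

theorem logNorm_nonneg {d : ℕ} (hd : 0 < d) (A : SL d) : 0 ≤ logNorm A :=
  Real.log_nonneg (one_le_slNorm hd A)

theorem logNorm_mul_le {d : ℕ} (hd : 0 < d) (A B : SL d) :
    logNorm (A * B) ≤ logNorm A + logNorm B := by
  rw [logNorm, logNorm, logNorm,
    ← Real.log_mul (slNorm_pos hd A).ne' (slNorm_pos hd B).ne']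
  exact Real.log_le_log (slNorm_pos hd _) (slNorm_mul_le A B)

theorem logNorm_inv_le {d : ℕ} (hd : 0 < d) (A : SL d) :
    logNorm A⁻¹ ≤ invConst d + d * logNorm A := by
  rw [logNorm, logNorm, invConst, ← Real.log_pow,
    ← Real.log_mul (by positivity) (pow_pos (slNorm_pos hd A) _).ne']
  exact Real.log_le_log (slNorm_pos hd _) (slNorm_inv_le hd A)

theorem measurable_logNorm (d : ℕ) : Measurable (logNorm : SL d → ℝ) :=
  Real.measurable_log.comp (continuous_slNorm d).measurable

theorem neg_le_log_norm_slVec {d : ℕ} (hd : 0 < d) (A : SL d) (y : Sph d) :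
    -(invConst d + d * logNorm A) ≤ Real.log ‖slVec A (y : Eucl d)‖ := by
  have hpos : 0 < ‖slVec A (y : Eucl d)‖ := norm_pos_iff.2 (slVec_ne_zero A (sph_ne_zero y))
  have h : 1 ≤ slNorm A⁻¹ * ‖slVec A (y : Eucl d)‖ := by
    have := norm_slVec_le A⁻¹ (slVec A (y : Eucl d))
    rwa [slVec_inv_slVec, sph_norm] at this
  have h' := Real.log_nonneg h
  rw [Real.log_mul (slNorm_pos hd _).ne' hpos.ne'] at h'
  have := logNorm_inv_le hd A
  rw [logNorm] at this
  linarith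

theorem exists_logNorm_mul_mul_ge {d : ℕ} (hd : 0 < d) (B S : SL d) {δ : ℝ} (hδ : 0 < δ) :
    ∃ x v : Sph d, ∀ R : SL d,
      logNorm S + logNorm B - d * logNorm R - 2 * invConst d - |Real.log δ| -
        ((fun R => sphAct R x) ⁻¹' slab v δ).indicator (fun _ => (d + 1) * logNorm B) R ≤
      logNorm (B * (R * S)) := by
  obtain ⟨x₀, hx₀⟩ := exists_norm_slVec_eq hd S
  obtain ⟨v, hv⟩ := exists_slNorm_mul_inner_le hd B
  refine ⟨sphAct S x₀, v, fun R => ?_⟩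
  set x := sphAct S x₀
  set y := sphAct R x
  have hc := invConst_nonneg hd
  have hRx : 0 < ‖slVec R (x : Eucl d)‖ := norm_pos_iff.2 (slVec_ne_zero R (sph_ne_zero x))
  have hBy : 0 < ‖slVec B (y : Eucl d)‖ := norm_pos_iff.2 (slVec_ne_zero B (sph_ne_zero y))
  have hle : slNorm S * (‖slVec R (x : Eucl d)‖ * ‖slVec B (y : Eucl d)‖) ≤
      slNorm (B * (R * S)) := by
    have h := norm_slVec_le (B * (R * S)) (x₀ : Eucl d)
    rw [slVec_mul, slVec_mul, ← norm_smul_sphAct S x₀, slVec_smul, ← norm_smul_sphAct R x,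
      slVec_smul, slVec_smul, norm_smul, norm_smul, norm_norm, norm_norm, hx₀, sph_norm,
      mul_one] at h
    exact h
  have hlog := Real.log_le_log (mul_pos (slNorm_pos hd S) (mul_pos hRx hBy)) hle
  rw [Real.log_mul (slNorm_pos hd S).ne' (mul_pos hRx hBy).ne',
    Real.log_mul hRx.ne' hBy.ne'] at hlog
  have hR := neg_le_log_norm_slVec hd R x
  have habs := neg_abs_le (Real.log δ)
  simp only [logNorm] at hR ⊢
  by_cases hy : y ∈ slab v δ
  · rw [Set.indicator_of_mem (Set.mem_preimage.2 hy)]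
    have hB := neg_le_log_norm_slVec hd B y
    have := abs_nonneg (Real.log δ)
    simp only [logNorm] at hB
    linarith
  · rw [Set.indicator_of_notMem (mt Set.mem_preimage.1 hy)]
    have hyδ : δ < |inner ℝ (y : Eucl d) (v : Eucl d)| := not_le.1 hy
    have hB := Real.log_le_log (mul_pos (slNorm_pos hd B) hδ)
      ((mul_le_mul_of_nonneg_left hyδ.le (slNorm_nonneg B)).trans (hv y))
    rw [Real.log_mul (slNorm_pos hd B).ne' hδ.ne'] at hB
    linarith

/-! ### Expected logarithms of norms -/

theorem FiniteMomentCondition.integrable_logNorm {d : ℕ} (hd : 0 < d) {γ C : ℝ} (hγ : 0 < γ)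
    {μ : ProbabilityMeasure (SL d)} (h : FiniteMomentCondition γ C μ) :
    Integrable logNorm (μ : Measure (SL d)) ∧ ∫ A, logNorm A ∂(μ : Measure (SL d)) ≤ C / γ := by
  have hle : ∀ A : SL d, logNorm A ≤ slNorm A ^ γ / γ := fun A =>
    Real.log_le_rpow_div (slNorm_nonneg A) hγ
  have hpow : ∀ A : SL d, 0 ≤ slNorm A ^ γ := fun A => Real.rpow_nonneg (slNorm_nonneg A) γ
  have hmeas : Measurable fun A : SL d => slNorm A ^ γ :=
    (continuous_slNorm d).measurable.pow_const γ
  have h_int : Integrable (fun A : SL d => slNorm A ^ γ) (μ : Measure (SL d)) := by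
    rw [← lintegral_ofReal_ne_top_iff_integrable hmeas.aestronglyMeasurable
      (Eventually.of_forall hpow)]
    exact h.ne_top
  have hlog : Integrable logNorm (μ : Measure (SL d)) :=
    (h_int.div_const γ).mono' (measurable_logNorm d).aestronglyMeasurable
      (Eventually.of_forall fun A => by
        rw [Real.norm_of_nonneg (logNorm_nonneg hd A)]; exact hle A)
  refine ⟨hlog, (integral_mono hlog (h_int.div_const γ) hle).trans ?_⟩
  rw [integral_div]
  refine div_le_div_of_nonneg_right ?_ hγ.le
  have hC : 0 < C := ENNReal.ofReal_pos.1 (pos_of_gt h)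
  rw [integral_eq_lintegral_of_nonneg_ae (Eventually.of_forall hpow) hmeas.aestronglyMeasurable]
  exact ENNReal.toReal_le_of_le_ofReal hC.le (le_of_lt h)

theorem integral_logNorm_mconv {d : ℕ} {α β : Measure (SL d)} :
    ∫ A, logNorm A ∂(α ∗ₘ β) = ∫ p, logNorm (p.1 * p.2) ∂(α.prod β) :=
  integral_map measurable_mul.aemeasurable (measurable_logNorm d).aestronglyMeasurable

section Convolution

variable {d : ℕ} {α β σ : Measure (SL d)} [IsProbabilityMeasure α] [IsProbabilityMeasure β]
  [IsProbabilityMeasure σ]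

theorem integrable_const_add_logNorm (hα : Integrable logNorm α) (a b : ℝ) :
    Integrable (fun A => a + b * logNorm A) α :=
  (integrable_const _).add (hα.const_mul _)

theorem integral_const_add_logNorm (hα : Integrable logNorm α) (a b : ℝ) :
    ∫ A, (a + b * logNorm A) ∂α = a + b * ∫ A, logNorm A ∂α := by
  rw [integral_add (integrable_const _) (hα.const_mul _), integral_const_mul]
  simp

theorem integrable_logNorm_add (hα : Integrable logNorm α) (hβ : Integrable logNorm β) :
    Integrable (fun p : SL d × SL d => logNorm p.1 + logNorm p.2) (α.prod β) :=
  (hα.comp_fst β).add (hβ.comp_snd α)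

theorem integral_logNorm_add (hα : Integrable logNorm α) (hβ : Integrable logNorm β) :
    ∫ p, (logNorm p.1 + logNorm p.2) ∂(α.prod β) = ∫ A, logNorm A ∂α + ∫ A, logNorm A ∂β := by
  rw [integral_add (hα.comp_fst β) (hβ.comp_snd α), integral_fun_fst, integral_fun_snd]
  simp

theorem integrable_logNorm_mul (hd : 0 < d) (hα : Integrable logNorm α)
    (hβ : Integrable logNorm β) :
    Integrable (fun p : SL d × SL d => logNorm (p.1 * p.2)) (α.prod β) :=
  (integrable_logNorm_add hα hβ).mono'
    ((measurable_logNorm d).comp measurable_mul).aestronglyMeasurable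
    (Eventually.of_forall fun p => by
      rw [Real.norm_of_nonneg (logNorm_nonneg hd _)]
      exact logNorm_mul_le hd p.1 p.2)

theorem integrable_logNorm_mconv (hd : 0 < d) (hα : Integrable logNorm α)
    (hβ : Integrable logNorm β) : Integrable logNorm (α ∗ₘ β) :=
  (integrable_map_measure (measurable_logNorm d).aestronglyMeasurable
    measurable_mul.aemeasurable).2 (integrable_logNorm_mul hd hα hβ)

theorem integral_logNorm_mconv_le (hd : 0 < d) (hα : Integrable logNorm α)
    (hβ : Integrable logNorm β) :
    ∫ A, logNorm A ∂(α ∗ₘ β) ≤ ∫ A, logNorm A ∂α + ∫ A, logNorm A ∂β := by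
  rw [integral_logNorm_mconv, ← integral_logNorm_add hα hβ]
  exact integral_mono (integrable_logNorm_mul hd hα hβ) (integrable_logNorm_add hα hβ)
    fun p => logNorm_mul_le hd p.1 p.2

theorem integral_logNorm_right_le (hd : 0 < d) (hα : Integrable logNorm α)
    (hβ : Integrable logNorm β) :
    ∫ A, logNorm A ∂β ≤ invConst d + d * ∫ A, logNorm A ∂α + ∫ A, logNorm A ∂(α ∗ₘ β) := by
  have h₁ : Integrable (fun p : SL d × SL d => invConst d + d * logNorm p.1) (α.prod β) :=
    (integrable_const _).add ((hα.comp_fst β).const_mul _)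
  have h₂ := integrable_logNorm_mul hd hα hβ
  have hle : ∫ p : SL d × SL d, logNorm p.2 ∂(α.prod β) ≤
      ∫ p : SL d × SL d, (invConst d + d * logNorm p.1 + logNorm (p.1 * p.2)) ∂(α.prod β) := by
    refine integral_mono (hβ.comp_snd α) (h₁.add h₂) fun p => ?_
    have h := logNorm_mul_le hd p.1⁻¹ (p.1 * p.2)
    rw [inv_mul_cancel_left] at h
    have h' := logNorm_inv_le hd p.1
    simp only
    linarith
  rw [integral_add h₁ h₂, integral_add (integrable_const _) ((hα.comp_fst β).const_mul _),
    integral_const_mul, integral_fun_fst, integral_fun_snd] at hle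
  rw [integral_logNorm_mconv]
  simpa using hle

theorem integral_logNorm_mul_mconv_ge (hd : 0 < d) (hβ : Integrable logNorm β)
    (hσ : Integrable logNorm σ) {δ η : ℝ} (hδ : 0 < δ)
    (hslab : ∀ x v : Sph d, β.real ((fun R => sphAct R x) ⁻¹' slab v δ) ≤ η) (B : SL d) :
    ∫ S, logNorm S ∂σ + (1 - (d + 1) * η) * logNorm B -
        (d * ∫ R, logNorm R ∂β + 2 * invConst d + |Real.log δ|) ≤
      ∫ Q, logNorm (B * Q) ∂(β ∗ₘ σ) := by
  have hmul : Measurable fun p : SL d × SL d => logNorm (B * (p.1 * p.2)) :=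
    (measurable_logNorm d).comp (measurable_mul.const_mul B)
  have h_int : Integrable (fun p : SL d × SL d => logNorm (B * (p.1 * p.2))) (β.prod σ) := by
    refine ((integrable_const (logNorm B)).add (integrable_logNorm_add hβ hσ)).mono'
      hmul.aestronglyMeasurable (Eventually.of_forall fun p => ?_)
    rw [Real.norm_of_nonneg (logNorm_nonneg hd _)]
    exact (logNorm_mul_le hd _ _).trans (add_le_add_right (logNorm_mul_le hd _ _) _)
  have hmap : ∫ Q, logNorm (B * Q) ∂(β ∗ₘ σ) =
      ∫ p : SL d × SL d, logNorm (B * (p.1 * p.2)) ∂(β.prod σ) :=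
    integral_map measurable_mul.aemeasurable
      ((measurable_logNorm d).comp (measurable_const_mul B)).aestronglyMeasurable
  rw [hmap, integral_prod_symm _ h_int]
  have hconst : ∫ S, logNorm S ∂σ + (1 - (d + 1) * η) * logNorm B -
        (d * ∫ R, logNorm R ∂β + 2 * invConst d + |Real.log δ|) =
      ∫ S, (logNorm S + ((1 - (d + 1) * η) * logNorm B -
        (d * ∫ R, logNorm R ∂β + 2 * invConst d + |Real.log δ|))) ∂σ := by
    rw [integral_add hσ (integrable_const _)]
    simp
    ring
  rw [hconst]
  refine integral_mono_ae (hσ.add (integrable_const _)) h_int.integral_prod_right ?_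
  filter_upwards [h_int.prod_left_ae] with S hS
  obtain ⟨x, v, hxv⟩ := exists_logNorm_mul_mul_ge hd B S hδ
  set E := (fun R => sphAct R x) ⁻¹' slab v δ with hE
  have hEm : MeasurableSet E :=
    ((isClosed_slab v δ).preimage (continuous_sphAct_left x)).measurableSet
  have heq : (fun R : SL d => logNorm S + logNorm B - d * logNorm R - 2 * invConst d -
      |Real.log δ|) = fun R => (logNorm S + logNorm B - 2 * invConst d - |Real.log δ|) +
        -d * logNorm R := by
    ext R
    ring
  have h₁ : Integrable (fun R : SL d => logNorm S + logNorm B - d * logNorm R -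
      2 * invConst d - |Real.log δ|) β :=
    heq ▸ integrable_const_add_logNorm hβ _ _
  have h₂ : Integrable (E.indicator fun _ => (d + 1) * logNorm B) β :=
    (integrable_const _).indicator hEm
  have hmono := integral_mono (h₁.sub h₂) hS hxv
  have hsub := integral_sub h₁ h₂
  rw [heq, integral_const_add_logNorm hβ, integral_indicator_const _ hEm, smul_eq_mul] at hsub
  have hη := mul_le_mul_of_nonneg_right (hslab x v)
    (mul_nonneg (by positivity : (0 : ℝ) ≤ d + 1) (logNorm_nonneg hd B))
  have hmono' := hsub.symm.trans_le hmono
  linarith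

theorem integral_logNorm_mconv_mconv_ge (hd : 0 < d) (hα : Integrable logNorm α)
    (hβ : Integrable logNorm β) (hσ : Integrable logNorm σ) {δ η : ℝ} (hδ : 0 < δ)
    (hslab : ∀ x v : Sph d, β.real ((fun R => sphAct R x) ⁻¹' slab v δ) ≤ η) :
    ∫ S, logNorm S ∂σ + (1 - (d + 1) * η) * ∫ B, logNorm B ∂α -
        (d * ∫ R, logNorm R ∂β + 2 * invConst d + |Real.log δ|) ≤
      ∫ A, logNorm A ∂(α ∗ₘ (β ∗ₘ σ)) := by
  have h_int := integrable_logNorm_mul hd hα (integrable_logNorm_mconv hd hβ hσ)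
  rw [integral_logNorm_mconv, integral_prod _ h_int]
  set c := ∫ S, logNorm S ∂σ
  set c' := d * ∫ R, logNorm R ∂β + 2 * invConst d + |Real.log δ|
  refine le_of_eq_of_le ?_ (integral_mono
    (integrable_const_add_logNorm hα (c - c') (1 - (d + 1) * η)) h_int.integral_prod_left
    fun B => le_of_eq_of_le ?_ (integral_logNorm_mul_mconv_ge hd hβ hσ hδ hslab B))
  · rw [integral_const_add_logNorm hα]
    ring
  · simp only [c, c']
    ring

end Convolution

theorem integrable_logNorm_segLaw {d : ℕ} (hd : 0 < d) {μ : ℕ → ProbabilityMeasure (SL d)}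
    {M : ℝ} (hμ : ∀ i, Integrable logNorm (μ i : Measure (SL d)) ∧
      ∫ A, logNorm A ∂(μ i : Measure (SL d)) ≤ M) (n j : ℕ) :
    Integrable logNorm (segLaw μ n j) ∧ ∫ A, logNorm A ∂(segLaw μ n j) ≤ j * M := by
  induction j with
  | zero =>
    have h : logNorm (1 : SL d) = 0 := by simp [logNorm, slNorm_one hd]
    have hm := (measurable_logNorm d).stronglyMeasurable
    refine ⟨integrable_dirac' hm (by simp), ?_⟩
    rw [segLaw, integral_dirac' _ _ hm, h]
    simp
  | succ j ih =>
    refine ⟨integrable_logNorm_mconv hd (hμ _).1 ih.1,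
      (integral_logNorm_mconv_le hd (hμ _).1 ih.1).trans ?_⟩
    push_cast
    linarith [(hμ (n + j)).2, ih.2]

theorem IsProductMeasure.Lseg_eq {d : ℕ} {μ : ℕ → ProbabilityMeasure (SL d)}
    {ℙ : Measure (ℕ → SL d)} (hℙ : IsProductMeasure μ ℙ) (n j : ℕ) :
    Lseg ℙ n (n + j) = ∫ A, logNorm A ∂(segLaw μ n j) := by
  have hm : Measurable fun ω : ℕ → SL d => T ω (n + j) * (T ω n)⁻¹ :=
    (measurable_T _).mul (measurable_T _).inv
  rw [← hℙ.map_seg n j, integral_map hm.aemeasurable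
    (measurable_logNorm d).aestronglyMeasurable]
  rfl

theorem IsProductMeasure.L_eq {d : ℕ} {μ : ℕ → ProbabilityMeasure (SL d)}
    {ℙ : Measure (ℕ → SL d)} (hℙ : IsProductMeasure μ ℙ) (n : ℕ) :
    L ℙ n = ∫ A, logNorm A ∂(segLaw μ 0 n) := by
  rw [← hℙ.Lseg_eq 0 n, zero_add]
  simp [L, Lseg, T]

/-- **Almost-superadditivity of the expected log-norms** (Lemma 3.6).
For any `ε > 0` there is `C_ε` (depending only on `ε` and `K`) such that for all `n ≤ m`,
`L_m ≥ Lₙ + (1 - ε) L_{[n,m]} - C_ε`. -/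
theorem almost_superadditivity
    (d : ℕ) (hd : 0 < d)
    (K : Set (ProbabilityMeasure (SL d))) (hK : IsCompact K)
    (γ C : ℝ) (hγ : 0 < γ)
    (hmom : ∀ μ ∈ K, FiniteMomentCondition γ C μ)
    (hmeas : ∀ μ ∈ K, MeasuresCondition μ)
    (hsp : ∀ μ ∈ K, SpacesCondition μ) :
    ∀ ε : ℝ, 0 < ε → ∃ Cε : ℝ,
      ∀ (μ : ℕ → ProbabilityMeasure (SL d)), (∀ i, μ i ∈ K) →
        ∀ ℙ : Measure (ℕ → SL d), IsProductMeasure μ ℙ →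
          ∀ n m : ℕ, n ≤ m → L ℙ n + (1 - ε) * Lseg ℙ n m - Cε ≤ L ℙ m := by
  intro ε hε
  set ε₁ := min ε 1
  have hε₁ : 0 < ε₁ := lt_min hε one_pos
  have hd1 : (0 : ℝ) < d + 1 := by positivity
  set η := ε₁ / (d + 1)
  have hη : 0 < η := div_pos hε₁ hd1
  have hηε : (d + 1) * η = ε₁ := mul_div_cancel₀ _ hd1.ne'
  obtain ⟨k, δ, hδ, hslab⟩ := exists_slab_lt hK hsp (ENNReal.ofReal_pos.2 hη)
  set M := |C / γ|
  have hM : 0 ≤ M := abs_nonneg _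
  have hc := invConst_nonneg hd
  refine ⟨(d + 1) * (k * M) + 2 * invConst d + |Real.log δ|, fun μ hμ ℙ hℙ n m hnm => ?_⟩
  have hμM : ∀ i, Integrable logNorm (μ i : Measure (SL d)) ∧
      ∫ A, logNorm A ∂(μ i : Measure (SL d)) ≤ M := fun i =>
    have h := (hmom _ (hμ i)).integrable_logNorm hd hγ
    ⟨h.1, h.2.trans (le_abs_self _)⟩
  have hseg := integrable_logNorm_segLaw hd hμM
  obtain ⟨j, rfl⟩ := Nat.exists_eq_add_of_le hnm
  have hlaw := segLaw_add μ 0 n j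
  rw [zero_add] at hlaw
  rw [hℙ.L_eq, hℙ.L_eq, hℙ.Lseg_eq]
  have hnonneg : 0 ≤ ∫ A, logNorm A ∂(segLaw μ n j) := integral_nonneg (logNorm_nonneg hd)
  rcases lt_or_ge j k with hjk | hkj
  · have h := integral_logNorm_right_le hd (hseg n j).1 (hseg 0 n).1
    rw [← hlaw] at h
    have hjM : ∫ A, logNorm A ∂(segLaw μ n j) ≤ k * M :=
      (hseg n j).2.trans (mul_le_mul_of_nonneg_right (by exact_mod_cast hjk.le) hM)
    have hdj := mul_le_mul_of_nonneg_left hjM (Nat.cast_nonneg (α := ℝ) d)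
    have hεj := mul_nonneg hε.le hnonneg
    linarith [abs_nonneg (Real.log δ)]
  · obtain ⟨i, rfl⟩ := Nat.exists_eq_add_of_le hkj
    have hprob : ∀ x v : Sph d,
        (segLaw μ n k).real ((fun R => sphAct R x) ⁻¹' slab v δ) ≤ η := by
      intro x v
      obtain ⟨ν, hν, hνx⟩ := exists_mem_reach_eq_map_segLaw hμ x n k
      have h := hslab ν hν v
      rw [hνx, Measure.map_apply (continuous_sphAct_left x).measurable
        (isClosed_slab v δ).measurableSet] at h
      exact ENNReal.toReal_le_of_le_ofReal hη.le h.le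
    have h := integral_logNorm_mconv_mconv_ge hd (hseg (n + k) i).1 (hseg n k).1 (hseg 0 n).1
      hδ hprob
    rw [← Measure.mconv_assoc, ← segLaw_add, ← hlaw, hηε] at h
    have hle := integral_logNorm_mconv_le hd (hseg (n + k) i).1 (hseg n k).1
    rw [← segLaw_add] at hle
    have hk := (hseg n k).2
    have hdk := mul_le_mul_of_nonneg_left hk (Nat.cast_nonneg (α := ℝ) d)
    have h₁ : (1 - ε) * ∫ A, logNorm A ∂(segLaw μ n (k + i)) ≤
        (1 - ε₁) * ∫ A, logNorm A ∂(segLaw μ n (k + i)) :=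
      mul_le_mul_of_nonneg_right (sub_le_sub_left (min_le_left _ _) _) hnonneg
    have h₂ := mul_le_mul_of_nonneg_left (hle.trans (add_le_add_right hk _))
      (sub_nonneg.2 (min_le_right ε 1))
    have h₃ : ε₁ * (k * M) ≥ 0 := by positivity
    linarith
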